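/- For any ν > 0 and any z = (z₁, z₂) ∈ ℝ², the normalized modified Bessel function satisfies 𝓘_ν(‖z‖) = (ν/π) ∫_{‖y‖ ≤ 1} e^{⟨z,y⟩} (1 - ‖y‖²)^{ν-1} dy, where the integral is over the closed unit disk in ℝ². -/

import Mathlib

open MeasureTheory Set

lemma hasSum_fun_eq {f g : ℕ → ℝ} {a : ℝ} (h : ∀ k, g k = f k) : HasSum f a ↔ HasSum g a := by
  rw [funext h]

lemma bA_sin (n : ℕ) : (∫ x in (0:ℝ)..Real.pi, Real.sin x ^ (2 * n)) =
    Real.pi * ((2*n).factorial / (4 ^ n * (n.factorial:ℝ)^2)) := by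
  rw [integral_sin_pow_even]
  congr 1
  induction n with
  | zero => simp
  | succ k ih =>
    rw [Finset.prod_range_succ, ih]
    have h : (2 * (k+1)).factorial = (2*k+2) * ((2*k+1) * (2*k).factorial) := by
      rw [show 2 * (k+1) = 2*k+1+1 by ring, Nat.factorial_succ, Nat.factorial_succ]
    rw [h, Nat.factorial_succ]
    have : (k.factorial:ℝ) ≠ 0 := by positivity
    push_cast
    field_simp
    ring

lemma bA_cosh (R : ℝ) : HasSum (fun k : ℕ => Real.pi * ((R/2)^(2*k) / (k.factorial:ℝ)^2))
    (∫ x in (0:ℝ)..Real.pi, Real.cosh (R * Real.sin x)) := by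
  have := intervalIntegral.hasSum_integral_of_dominated_convergence (μ := volume) (a := 0) (b := Real.pi)
    (F := fun (k:ℕ) x => (R * Real.sin x)^(2*k) / (2*k).factorial)
    (f := fun x => Real.cosh (R * Real.sin x)) (fun k _ => |R|^(2*k) / (2*k).factorial)
    (fun n => by apply Continuous.aestronglyMeasurable; fun_prop)
    (fun n => by
      refine Filter.Eventually.of_forall fun x _ => ?_
      rw [norm_div, norm_pow, norm_mul, Real.norm_eq_abs, Real.norm_eq_abs, Real.norm_natCast]
      gcongr
      exact mul_le_of_le_one_right (abs_nonneg _) (Real.abs_sin_le_one x))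
    (Filter.Eventually.of_forall fun x _ => (Real.hasSum_cosh |R|).summable)
    (by apply Continuous.intervalIntegrable; fun_prop)
    (Filter.Eventually.of_forall fun x _ => Real.hasSum_cosh _)
  refine (hasSum_fun_eq ?_).mp this; intro k
  simp_rw [mul_pow, mul_div_assoc, div_eq_mul_inv]
  rw [intervalIntegral.integral_const_mul, intervalIntegral.integral_mul_const, bA_sin]
  have : (k.factorial:ℝ) ≠ 0 := by positivity
  have : ((2*k).factorial:ℝ) ≠ 0 := by positivity
  rw [show (4:ℝ)^k = 2^(2*k) by rw [pow_mul]; norm_num]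
  simp only [mul_pow, inv_pow]
  field_simp

lemma bA_ang (a b R : ℝ) (hR : 0 ≤ R) (h : a^2 + b^2 = R^2) :
    (∫ θ in (-Real.pi)..Real.pi, Real.exp (a * Real.cos θ + b * Real.sin θ)) =
     2 * ∫ x in (0:ℝ)..Real.pi, Real.cosh (R * Real.sin x) := by
  obtain ⟨φ, ha, hb⟩ : ∃ φ : ℝ, a = R * Real.sin φ ∧ b = R * Real.cos φ := by
    have h1 : R = ‖(⟨b, a⟩ : ℂ)‖ := by
      rw [Complex.norm_def, Complex.normSq_mk, ← Real.sqrt_sq hR, ← h]; congr 1; ring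
    refine ⟨Complex.arg ⟨b, a⟩, ?_, ?_⟩
    · rw [h1, Complex.norm_mul_sin_arg]
    · rw [h1, Complex.norm_mul_cos_arg]
  have e1 : ∀ θ, a * Real.cos θ + b * Real.sin θ = R * Real.sin (θ + φ) := by
    intro θ; rw [Real.sin_add, ha, hb]; ring
  simp_rw [e1]
  rw [intervalIntegral.integral_comp_add_right (fun x => Real.exp (R * Real.sin x))]
  have hp : Function.Periodic (fun x => Real.exp (R * Real.sin x)) (2 * Real.pi) := by
    intro x; simp
  have := hp.intervalIntegral_add_eq (-Real.pi + φ) (-Real.pi)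
  rw [show -Real.pi + φ + 2 * Real.pi = Real.pi + φ by ring,
    show -Real.pi + 2 * Real.pi = Real.pi by ring] at this
  have ii : ∀ u v, IntervalIntegrable (fun x => Real.exp (R * Real.sin x)) volume u v := by
    intro u v; apply Continuous.intervalIntegrable; fun_prop
  have ij : ∀ u v, IntervalIntegrable (fun x => Real.exp (-(R * Real.sin x))) volume u v := by
    intro u v; apply Continuous.intervalIntegrable; fun_prop
  rw [this, ← intervalIntegral.integral_add_adjacent_intervals (ii _ 0) (ii 0 _)]
  have h2 : (∫ x in (-Real.pi)..0, Real.exp (R * Real.sin x)) = ∫ x in (0:ℝ)..Real.pi, Real.exp (-(R * Real.sin x)) := by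
    have := intervalIntegral.integral_comp_neg (a := 0) (b := Real.pi) (fun x => Real.exp (R * Real.sin x))
    simpa using this.symm
  rw [h2, ← intervalIntegral.integral_add (ij _ _) (ii _ _), ← intervalIntegral.integral_const_mul]
  congr 1; ext x; rw [Real.cosh_eq]; ring

lemma bB_beta (u v : ℝ) (hu : 0 < u) (hv : 0 < v) :
    IntegrableOn (fun x : ℝ => x^(u-1) * (1-x)^(v-1)) (Ioo 0 1) ∧
    ∫ x in Ioo (0:ℝ) 1, x^(u-1) * (1-x)^(v-1) = Real.Gamma u * Real.Gamma v / Real.Gamma (u+v) := by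
  have h1 := Complex.betaIntegral_convergent (u := u) (v := v) (by simpa) (by simpa)
  rw [intervalIntegrable_iff_integrableOn_Ioo_of_le (by simp)] at h1
  have e : ∀ x ∈ Ioo (0:ℝ) 1, (x : ℂ) ^ ((u:ℂ) - 1) * (1 - (x : ℂ)) ^ ((v:ℂ) - 1) = ((x^(u-1) * (1-x)^(v-1) : ℝ) : ℂ) := by
    intro x hx
    push_cast
    rw [Complex.ofReal_cpow hx.1.le, Complex.ofReal_cpow (by linarith [hx.2])]
    push_cast; rfl
  have h2 := h1.congr_fun e measurableSet_Ioo
  refine ⟨?_, ?_⟩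
  · simpa [IntegrableOn] using! h2.re
  · have h3 := ProbabilityTheory.beta_eq_betaIntegralReal u v hu hv
    rw [ProbabilityTheory.beta, Complex.betaIntegral, intervalIntegral.integral_of_le zero_le_one,
      integral_Ioc_eq_integral_Ioo, setIntegral_congr_fun measurableSet_Ioo e, integral_complex_ofReal, Complex.ofReal_re] at h3
    rw [h3]

lemma bB (ν : ℝ) (hν : 0 < ν) (k : ℕ) :
    IntegrableOn (fun r : ℝ => r^(2*k+1) * (1-r^2)^(ν-1)) (Ioo 0 1) ∧
    ∫ r in Ioo (0:ℝ) 1, r^(2*k+1) * (1-r^2)^(ν-1) =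
      k.factorial * Real.Gamma ν / (2 * Real.Gamma (k + ν + 1)) := by
  obtain ⟨h1, h2⟩ := bB_beta (k+1) ν (by positivity) hν
  have im : (fun r : ℝ => r^2) '' Ioo 0 1 = Ioo 0 1 := by
    ext x; constructor
    · rintro ⟨r, hr, rfl⟩; exact ⟨by have := hr.1; positivity, by have := hr.1; have := hr.2; simp only; nlinarith⟩
    · intro hx
      exact ⟨√x, ⟨Real.sqrt_pos.2 hx.1, by rw [Real.sqrt_lt' one_pos]; simpa using hx.2⟩, Real.sq_sqrt hx.1.le⟩
  have inj : InjOn (fun r : ℝ => r^2) (Ioo 0 1) := by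
    intro x hx y hy hxy
    exact (pow_left_inj₀ hx.1.le hy.1.le two_ne_zero).1 hxy
  have hd : ∀ x ∈ Ioo (0:ℝ) 1, HasDerivWithinAt (fun r : ℝ => r^2) (2*x) (Ioo 0 1) x := by
    intro x _; simpa using (hasDerivAt_pow 2 x).hasDerivWithinAt
  have e : ∀ x ∈ Ioo (0:ℝ) 1, |2*x| • ((x^2)^((k:ℝ)+1-1) * (1-x^2)^(ν-1)) = 2 * (x^(2*k+1) * (1-x^2)^(ν-1)) := by
    intro x hx
    rw [abs_of_pos (by linarith [hx.1]), add_sub_cancel_right, Real.rpow_natCast, smul_eq_mul]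
    ring
  rw [← im, integrableOn_image_iff_integrableOn_abs_deriv_smul measurableSet_Ioo hd inj] at h1
  rw [← im, integral_image_eq_integral_abs_deriv_smul measurableSet_Ioo hd inj,
    setIntegral_congr_fun measurableSet_Ioo e, integral_const_mul, Real.Gamma_nat_eq_factorial] at h2
  replace h1 := (h1.congr_fun e measurableSet_Ioo).const_mul (1/2)
  refine ⟨?_, ?_⟩
  · refine IntegrableOn.congr_fun h1 (fun x _ => ?_) measurableSet_Ioo
    simp
  · rw [show (k:ℝ)+ν+1 = k+1+ν by ring]
    rw [mul_comm 2 (Real.Gamma _), ← div_div, ← h2]; ring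

lemma bC_polar (ν : ℝ) (hν : 0 < ν) (a b : ℝ) :
    (∫ p : ℝ × ℝ, {p : ℝ × ℝ | p.1^2+p.2^2 ≤ 1}.indicator (fun p =>
      Real.exp (a * p.1 + b * p.2) * (1 - (p.1^2+p.2^2)) ^ (ν-1)) p) =
    ∫ r in Ioo (0:ℝ) 1, (r * (1-r^2)^(ν-1)) * ∫ θ in (-Real.pi)..Real.pi, Real.exp (a * r * Real.cos θ + b * r * Real.sin θ) := by
  rw [← integral_comp_polarCoord_symm]
  have key : ∀ p ∈ polarCoord.target, p.1 • ({p : ℝ × ℝ | p.1^2+p.2^2 ≤ 1}.indicator (fun p =>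
      Real.exp (a * p.1 + b * p.2) * (1 - (p.1^2+p.2^2)) ^ (ν-1)) (polarCoord.symm p)) =
      (Iic (1:ℝ) ×ˢ (univ : Set ℝ)).indicator (fun p =>
        Real.exp (a * p.1 * Real.cos p.2 + b * p.1 * Real.sin p.2) * ((p.1 * (1-p.1^2)^(ν-1)) * 1)) p := by
    rintro ⟨r, θ⟩ hp
    have hr : 0 < r := hp.1
    have hs : (r * Real.cos θ)^2 + (r * Real.sin θ)^2 = r^2 := by
      linear_combination r^2 * Real.sin_sq_add_cos_sq θ
    simp only [polarCoord_symm_apply, indicator_apply, mem_ofPred_eq, hs, mem_prod, mem_Iic, mem_univ, and_true,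
      sq_le_one_iff₀ hr.le, smul_eq_mul]
    split_ifs
    · ring_nf
    · simp
  have hB := (bB ν hν 0).1
  simp only [mul_zero, zero_add, pow_one] at hB
  rw [setIntegral_congr_fun polarCoord.open_target.measurableSet key,
    setIntegral_indicator (measurableSet_Iic.prod MeasurableSet.univ), polarCoord_target, prod_inter_prod,
    inter_univ, Ioi_inter_Iic, Measure.volume_eq_prod, setIntegral_prod, integral_Ioc_eq_integral_Ioo]
  · refine setIntegral_congr_fun measurableSet_Ioo fun r _ => ?_
    simp only
    rw [integral_mul_const, ← integral_Ioc_eq_integral_Ioo, ← intervalIntegral.integral_of_le (by linarith [Real.pi_pos]),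
      mul_one, mul_comm]
  · have h0 : Integrable (fun p : ℝ × ℝ => (p.1 * (1-p.1^2)^(ν-1)) * 1)
        ((volume.restrict (Ioc (0:ℝ) 1)).prod (volume.restrict (Ioo (-Real.pi) Real.pi))) := by
      refine Integrable.mul_prod (f := fun r : ℝ => r * (1-r^2)^(ν-1)) (g := fun _ : ℝ => (1:ℝ)) ?_ ?_
      · exact (integrableOn_Ioc_iff_integrableOn_Ioo).2 hB
      · exact integrable_const _
    rw [IntegrableOn, ← Measure.prod_restrict]
    refine h0.bdd_mul (c := Real.exp (|a| + |b|)) (by apply Continuous.aestronglyMeasurable; fun_prop) ?_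
    rw [Measure.prod_restrict]
    refine ae_restrict_of_forall_mem (measurableSet_Ioc.prod measurableSet_Ioo) ?_
    rintro ⟨r, θ⟩ ⟨hr, -⟩
    simp only at hr
    rw [Real.norm_eq_abs, Real.abs_exp, Real.exp_le_exp]
    have A : ∀ c s : ℝ, |s| ≤ 1 → c * r * s ≤ |c| := by
      intro c s hs
      refine (le_abs_self _).trans ?_
      rw [abs_mul, abs_mul, abs_of_pos hr.1, mul_assoc]
      exact mul_le_of_le_one_right (abs_nonneg _) (mul_le_one₀ hr.2 (abs_nonneg _) hs)
    exact add_le_add (A _ _ (Real.abs_cos_le_one _)) (A _ _ (Real.abs_sin_le_one _))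

lemma bC_radial (ν : ℝ) (hν : 0 < ν) (a b R : ℝ) (hR : 0 ≤ R) (h : a^2 + b^2 = R^2) :
    HasSum (fun k : ℕ => Real.pi * Real.Gamma ν * ((R/2)^(2*k) / (k.factorial * Real.Gamma (k + ν + 1))))
    (∫ r in Ioo (0:ℝ) 1, (r * (1-r^2)^(ν-1)) * ∫ θ in (-Real.pi)..Real.pi, Real.exp (a * r * Real.cos θ + b * r * Real.sin θ)) := by
  have hB := (bB ν hν 0).1
  simp only [mul_zero, zero_add, pow_one] at hB
  have hm : ∀ r ∈ Ioo (0:ℝ) 1, 0 ≤ r * (1-r^2)^(ν-1) := fun r hr =>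
    mul_nonneg hr.1.le (Real.rpow_nonneg (by nlinarith [hr.1, hr.2]) _)
  have := hasSum_integral_of_dominated_convergence (μ := volume.restrict (Ioo (0:ℝ) 1))
    (F := fun (k:ℕ) r => (2 * (Real.pi * ((R/2)^(2*k) / (k.factorial:ℝ)^2))) * (r^(2*k+1) * (1-r^2)^(ν-1)))
    (f := fun r => (r * (1-r^2)^(ν-1)) * ∫ θ in (-Real.pi)..Real.pi, Real.exp (a * r * Real.cos θ + b * r * Real.sin θ))
    (fun k r => (Real.pi * ((R/2)^(2*k) / (k.factorial:ℝ)^2)) * (2 * (r * (1-r^2)^(ν-1))))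
    (fun k => ((bB ν hν k).1.const_mul _).aestronglyMeasurable)
    (fun k => by
      refine ae_restrict_of_forall_mem measurableSet_Ioo fun r hr => ?_
      have h1 := hm r hr
      have h2 : r^(2*k) ≤ 1 := pow_le_one₀ hr.1.le hr.2.le
      have h3 : 0 ≤ r^(2*k) := pow_nonneg hr.1.le _
      rw [show (2 * (Real.pi * ((R/2)^(2*k) / (k.factorial:ℝ)^2))) * (r^(2*k+1) * (1-r^2)^(ν-1)) =
        ((Real.pi * ((R/2)^(2*k) / (k.factorial:ℝ)^2)) * (2 * (r * (1-r^2)^(ν-1)))) * r^(2*k) by ring]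
      rw [Real.norm_of_nonneg (by positivity)]
      exact mul_le_of_le_one_right (by positivity) h2)
    (Filter.Eventually.of_forall fun r => (bA_cosh R).summable.mul_right _)
    (by
      simp_rw [tsum_mul_right]
      exact (hB.const_mul 2).const_mul _)
    (by
      refine ae_restrict_of_forall_mem measurableSet_Ioo fun r hr => ?_
      rw [bA_ang (a*r) (b*r) (R*r) (mul_nonneg hR hr.1.le) (by linear_combination r^2 * h)]
      have := ((bA_cosh (R*r)).mul_left 2).mul_left (r * (1-r^2)^(ν-1))
      refine (hasSum_fun_eq ?_).mp this; intro k
      rw [mul_div_right_comm, mul_pow]; ring)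
  refine (hasSum_fun_eq ?_).mp this; intro k
  rw [integral_const_mul, (bB ν hν k).2]
  have : (k.factorial:ℝ) ≠ 0 := by positivity
  have : Real.Gamma (k + ν + 1) ≠ 0 := (Real.Gamma_pos_of_pos (by positivity)).ne'
  field_simp

noncomputable def besselI (ν t : ℝ) : ℝ :=
  Real.Gamma (ν + 1) * ∑' n : ℕ, (t / 2) ^ (2 * n) / (n.factorial * Real.Gamma (n + ν + 1))

theorem stmt0 (ν : ℝ) (hν : 0 < ν) (z : EuclideanSpace ℝ (Fin 2)) :
    besselI ν ‖z‖ = ν / Real.pi *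
      ∫ y in Metric.closedBall (0 : EuclideanSpace ℝ (Fin 2)) 1,
        Real.exp (z 0 * y 0 + z 1 * y 1) * (1 - ‖y‖ ^ 2) ^ (ν - 1) := by
  have hT : (∫ y in Metric.closedBall (0 : EuclideanSpace ℝ (Fin 2)) 1,
        Real.exp (z 0 * y 0 + z 1 * y 1) * (1 - ‖y‖ ^ 2) ^ (ν - 1)) =
      (∫ p : ℝ × ℝ, {p : ℝ × ℝ | p.1^2+p.2^2 ≤ 1}.indicator (fun p =>
      Real.exp (z 0 * p.1 + z 1 * p.2) * (1 - (p.1^2+p.2^2)) ^ (ν-1)) p) := by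
    have mp := (EuclideanSpace.volume_preserving_symm_measurableEquiv_toLp (Fin 2)).trans
      (volume_preserving_finTwoArrow ℝ)
    rw [← mp.integral_comp ((MeasurableEquiv.toLp 2 (Fin 2 → ℝ)).symm.trans
      MeasurableEquiv.finTwoArrow).measurableEmbedding, ← integral_indicator Metric.isClosed_closedBall.measurableSet]
    refine integral_congr_ae (Filter.Eventually.of_forall fun y => ?_)
    have hn : ‖y‖^2 = y 0 ^ 2 + y 1 ^ 2 := by
      rw [EuclideanSpace.real_norm_sq_eq, Fin.sum_univ_two]
    have hle : ‖y‖ ≤ 1 ↔ y 0 ^ 2 + y 1 ^ 2 ≤ 1 := by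
      rw [← hn, sq_le_one_iff₀ (norm_nonneg y)]
    change _ = {p : ℝ × ℝ | p.1^2+p.2^2 ≤ 1}.indicator (fun p =>
      Real.exp (z 0 * p.1 + z 1 * p.2) * (1 - (p.1^2+p.2^2)) ^ (ν-1)) (y 0, y 1)
    have hle2 : (y 0, y 1) ∈ {p : ℝ × ℝ | p.1^2+p.2^2 ≤ 1} ↔ ‖y‖ ≤ 1 := hle.symm
    by_cases hy : ‖y‖ ≤ 1
    · rw [indicator_of_mem (mem_closedBall_zero_iff.2 hy), indicator_of_mem (hle2.2 hy), hn]
    · rw [indicator_of_notMem (fun h => hy (mem_closedBall_zero_iff.1 h)),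
        indicator_of_notMem (fun h => hy (hle2.1 h))]
  have hz : z 0 ^ 2 + z 1 ^ 2 = ‖z‖^2 := by
    rw [EuclideanSpace.real_norm_sq_eq, Fin.sum_univ_two]
  rw [hT, bC_polar ν hν, ← (bC_radial ν hν (z 0) (z 1) ‖z‖ (norm_nonneg z) hz).tsum_eq, tsum_mul_left,
    besselI, Real.Gamma_add_one hν.ne']
  have := Real.pi_ne_zero
  field_simp
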